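/- arXiv:1008.2716 — 2 statements merged into one kernel-verified Lean document; each statement's English description precedes it below -/
import Mathlib

section
/- Let A be an arbitrary 2-index real array on n-dimensional Minkowski vector space with superenergy tensor T, and let ℓ be a null vector. Then T_{αβλμ}ℓ^βℓ^λℓ^μ = 0 for all α if and only if ℓ_μ(A_{τν}ℓ^ν) − ℓ_τ(A_{μν}ℓ^ν) = 0 for all μ,τ. -/
open Finset

noncomputable section

/-- Sign of the `i`-th diagonal entry of the Minkowski metric diag(-1,1,...,1). -/
def sgn {n : ℕ} (i : Fin n) : ℝ := if (i : ℕ) = 0 then -1 else 1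

/-- The Minkowski metric components η_{ij} (= η^{ij}). -/
def eta {n : ℕ} (i j : Fin n) : ℝ := if i = j then sgn i else 0

/-- Minkowski square η(v,v) of a vector. -/
def mSq {n : ℕ} (v : Fin n → ℝ) : ℝ := ∑ i, sgn i * v i * v i

/-- Lowered components v_i = η_{ij} v^j. -/
def lo {n : ℕ} (v : Fin n → ℝ) (i : Fin n) : ℝ := sgn i * v i

/-- The superenergy tensor of an arbitrary 2-index array A (no symmetries assumed). -/
def SE2 {n : ℕ} (A : Fin n → Fin n → ℝ) (a b l m : Fin n) : ℝ :=
  A a l * A b m + A b l * A a m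
  - eta a b * (∑ r, sgn r * A r l * A r m)
  - eta l m * (∑ r, sgn r * A a r * A b r)
  + (1/2) * eta a b * eta l m * (∑ r, ∑ s, sgn r * sgn s * A r s * A r s)

theorem mSq_lo {n : ℕ} (v : Fin n → ℝ) : mSq (lo v) = mSq v := by
  refine sum_congr rfl fun i _ => ?_
  unfold lo sgn
  split_ifs <;> ring

theorem sum_eta_mul {n : ℕ} (i : Fin n) (v : Fin n → ℝ) : ∑ j, eta i j * v j = lo v i := by
  simp [eta, lo]

theorem sum_sum_eta_mul_mul {n : ℕ} (v : Fin n → ℝ) :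
    ∑ i, ∑ j, eta i j * (v i * v j) = mSq v := by
  simp [eta, mSq, mul_assoc]

theorem sum_sum_mul_mul {n : ℕ} (x y v : Fin n → ℝ) :
    ∑ i, ∑ j, x i * y j * (v i * v j) = (∑ i, x i * v i) * ∑ j, y j * v j := by
  rw [sum_mul_sum]
  exact sum_congr rfl fun i _ => sum_congr rfl fun j _ => by ring

theorem sum_sum_quadratic {n : ℕ} (A : Fin n → Fin n → ℝ) (v : Fin n → ℝ) :
    ∑ i, ∑ j, (∑ r, sgn r * A r i * A r j) * (v i * v j) = mSq fun r => ∑ i, A r i * v i := by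
  have h (r : Fin n) : sgn r * (∑ i, A r i * v i) * (∑ j, A r j * v j) =
      ∑ i, ∑ j, sgn r * A r i * A r j * (v i * v j) := by
    rw [mul_assoc, ← sum_sum_mul_mul]
    simp only [mul_sum, mul_assoc]
  simp only [mSq, h, sum_mul]
  conv_rhs => rw [sum_comm]
  exact sum_congr rfl fun i _ => sum_comm

/-- A null vector whose time component vanishes is zero. -/
theorem eq_zero_of_mSq_eq_zero {n : ℕ} {v : Fin n → ℝ} (h : mSq v = 0)
    (h0 : ∀ i : Fin n, (i : ℕ) = 0 → v i = 0) (i : Fin n) : v i = 0 := by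
  have hsq : ∀ j : Fin n, sgn j * v j * v j = v j ^ 2 := by
    intro j
    by_cases hj : (j : ℕ) = 0
    · simp [h0 j hj]
    · simp [sgn, hj, sq]
  simp only [mSq, hsq] at h
  rw [sum_eq_zero_iff_of_nonneg fun j _ => sq_nonneg (v j)] at h
  exact pow_eq_zero_iff two_ne_zero |>.mp (h i (mem_univ i))

theorem mSq_sub {n : ℕ} (a b : ℝ) (v w : Fin n → ℝ) :
    mSq (fun i => a * w i - b * lo v i) =
      a ^ 2 * mSq w - 2 * a * b * (∑ i, w i * v i) + b ^ 2 * mSq v := by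
  rw [← mSq_lo v]
  simp only [mSq, mul_sum, ← sum_sub_distrib, ← sum_add_distrib]
  refine sum_congr rfl fun i _ => ?_
  unfold lo sgn
  split_ifs <;> ring

/-- Orthogonal null vectors are proportional. -/
theorem lo_mul_eq_of_orthogonal {n : ℕ} {v w : Fin n → ℝ} (hv0 : v ≠ 0) (hv : mSq v = 0)
    (hw : mSq w = 0) (hvw : ∑ i, w i * v i = 0) (i j : Fin n) :
    lo v i * w j - lo v j * w i = 0 := by
  obtain ⟨z, hz⟩ : ∃ z : Fin n, (z : ℕ) = 0 := ⟨⟨0, i.pos⟩, rfl⟩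
  have hvz : lo v z ≠ 0 := by
    intro h
    refine hv0 (funext fun k => eq_zero_of_mSq_eq_zero hv (fun l hl => ?_) k)
    obtain rfl : l = z := Fin.ext (hl.trans hz.symm)
    simpa [lo, sgn, hl] using h
  have key (k : Fin n) : lo v z * w k - w z * lo v k = 0 := by
    refine eq_zero_of_mSq_eq_zero (v := fun k => lo v z * w k - w z * lo v k) ?_ ?_ k
    · rw [mSq_sub, hv, hw, hvw]
      ring
    · intro l hl
      obtain rfl : l = z := Fin.ext (hl.trans hz.symm)
      ring
  refine (mul_eq_zero.mp ?_).resolve_left hvz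
  linear_combination lo v i * key j - lo v j * key i

theorem sum_sum_SE2 {n : ℕ} (A : Fin n → Fin n → ℝ) {v : Fin n → ℝ} (hv : mSq v = 0)
    (a b : Fin n) :
    ∑ l, ∑ m, SE2 A a b l m * (v l * v m) =
      2 * (∑ i, A a i * v i) * (∑ i, A b i * v i)
        - eta a b * mSq fun r => ∑ i, A r i * v i := by
  have h (l m : Fin n) : SE2 A a b l m * (v l * v m) =
      A a l * A b m * (v l * v m) + A b l * A a m * (v l * v m)
      - eta a b * ((∑ r, sgn r * A r l * A r m) * (v l * v m))
      + (1 / 2 * eta a b * (∑ r, ∑ s, sgn r * sgn s * A r s * A r s)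
          - ∑ r, sgn r * A a r * A b r) * (eta l m * (v l * v m)) := by
    unfold SE2
    ring
  simp only [h, sum_add_distrib, sum_sub_distrib, ← mul_sum]
  rw [sum_sum_mul_mul, sum_sum_mul_mul, sum_sum_quadratic, sum_sum_eta_mul_mul, hv]
  ring

/-- The superenergy tensor contracted three times with a null vector. -/
theorem sum_sum_sum_SE2 {n : ℕ} (A : Fin n → Fin n → ℝ) {v : Fin n → ℝ} (hv : mSq v = 0)
    (a : Fin n) :
    ∑ b, ∑ l, ∑ m, SE2 A a b l m * v b * v l * v m =
      2 * (∑ i, A a i * v i) * (∑ b, (∑ i, A b i * v i) * v b)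
        - lo v a * mSq fun r => ∑ i, A r i * v i := by
  have h (b : Fin n) : ∑ l, ∑ m, SE2 A a b l m * v b * v l * v m =
      2 * (∑ i, A a i * v i) * ((∑ i, A b i * v i) * v b)
        - (eta a b * v b) * mSq fun r => ∑ i, A r i * v i := by
    have hfactor : ∑ l, ∑ m, SE2 A a b l m * v b * v l * v m =
        (∑ l, ∑ m, SE2 A a b l m * (v l * v m)) * v b := by
      simp only [sum_mul]
      exact sum_congr rfl fun l _ => sum_congr rfl fun m _ => by ring
    rw [hfactor, sum_sum_SE2 A hv]
    ring
  simp only [h, sum_sub_distrib]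
  rw [← mul_sum, ← sum_mul, sum_eta_mul]

/-- T_{αβλμ}ℓ^βℓ^λℓ^μ = 0 iff ℓ_{[μ}A_{τ]ν}ℓ^ν = 0, for null ℓ. -/
theorem stmt_15 {n : ℕ} (hn : 2 ≤ n) (A : Fin n → Fin n → ℝ)
    (ℓ : Fin n → ℝ) (hℓ0 : ℓ ≠ 0) (hnull : mSq ℓ = 0) :
    (∀ a : Fin n, ∑ b, ∑ l, ∑ m, SE2 A a b l m * ℓ b * ℓ l * ℓ m = 0) ↔
      (∀ m t : Fin n,
        lo ℓ m * (∑ v, A t v * ℓ v) - lo ℓ t * (∑ v, A m v * ℓ v) = 0) := by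
  simp only [sum_sum_sum_SE2 A hnull]
  set w : Fin n → ℝ := fun r => ∑ i, A r i * ℓ i
  change (∀ a, 2 * w a * (∑ b, w b * ℓ b) - lo ℓ a * mSq w = 0) ↔
    ∀ m t, lo ℓ m * w t - lo ℓ t * w m = 0
  have hlo : ∑ a, lo ℓ a * ℓ a = 0 := hnull
  obtain ⟨k, hk⟩ : ∃ k, lo ℓ k ≠ 0 := by
    obtain ⟨k, hk⟩ := Function.ne_iff.mp hℓ0
    refine ⟨k, mul_ne_zero ?_ hk⟩
    unfold sgn
    split_ifs <;> norm_num
  constructor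
  · intro h
    have hp : ∑ b, w b * ℓ b = 0 := by
      have hsum : ∑ a, (2 * w a * (∑ b, w b * ℓ b) - lo ℓ a * mSq w) * ℓ a =
          2 * (∑ b, w b * ℓ b) * (∑ a, w a * ℓ a) - mSq w * ∑ a, lo ℓ a * ℓ a := by
        rw [mul_sum univ (fun a => w a * ℓ a), mul_sum univ (fun a => lo ℓ a * ℓ a),
          ← sum_sub_distrib]
        exact sum_congr rfl fun a _ => by ring
      simpa [h, hlo] using hsum
    have hq : mSq w = 0 := by simpa [hp, hk] using h k
    exact lo_mul_eq_of_orthogonal hℓ0 hnull hq hp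
  · intro h a
    obtain ⟨c, hc⟩ : ∃ c, ∀ t, w t = c * lo ℓ t := by
      refine ⟨w k / lo ℓ k, fun t => ?_⟩
      field_simp
      linear_combination h k t
    have hp : ∑ b, w b * ℓ b = 0 := by
      simp only [hc, mul_assoc, ← mul_sum, hlo, mul_zero]
    have hq : mSq w = 0 := by
      have := mSq_sub 0 (-c) ℓ w
      simpa [← hc, hnull] using this
    simp [hp, hq]
end
end

section
/- Let A be an arbitrary 2-index real array on n-dimensional Minkowski vector space with superenergy tensor T, and let ℓ be a null vector. Then T_{αβλμ}ℓ^αℓ^β = 0 for all λ,μ if and only if ℓ^μA_{μν} = 0 for all ν; and T_{αβλμ}ℓ^λℓ^μ = 0 for all α,β if and only if A_{μν}ℓ^ν = 0 for all μ. -/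
open Finset

noncomputable section

/-- Contracting the metric twice with a vector gives its Minkowski square. -/
lemma sum_sum_eta_mul {n : ℕ} (v : Fin n → ℝ) :
    ∑ a, ∑ b, eta a b * v a * v b = mSq v := by
  simp [eta, mSq, ite_mul]

lemma sum_sum_mul_mul_s16 {n : ℕ} (f g v : Fin n → ℝ) :
    ∑ a, ∑ b, f a * g b * v a * v b = (∑ a, v a * f a) * ∑ b, v b * g b := by
  rw [Finset.sum_mul_sum]
  exact Finset.sum_congr rfl fun a _ => Finset.sum_congr rfl fun b _ => by ring

/-- Contracting the first pair of indices of the superenergy tensor with a null vector. -/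
lemma sum_sum_SE2_of_null {n : ℕ} (A : Fin n → Fin n → ℝ) (v : Fin n → ℝ)
    (hv : mSq v = 0) (l m : Fin n) :
    ∑ a, ∑ b, SE2 A a b l m * v a * v b =
      2 * (∑ a, v a * A a l) * (∑ a, v a * A a m)
        - eta l m * mSq (fun r => ∑ a, v a * A a r) := by
  have hQ : ∑ a, ∑ b, (∑ r, sgn r * A a r * A b r) * v a * v b =
      mSq (fun r => ∑ a, v a * A a r) := by
    simp only [mSq, Finset.sum_mul]
    rw [Finset.sum_congr rfl fun a _ => Finset.sum_comm, Finset.sum_comm]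
    refine Finset.sum_congr rfl fun r _ => ?_
    rw [mul_assoc, ← sum_sum_mul_mul_s16, Finset.mul_sum]
    refine Finset.sum_congr rfl fun a _ => ?_
    rw [Finset.mul_sum]
    exact Finset.sum_congr rfl fun b _ => by ring
  set P := ∑ r, sgn r * A r l * A r m with hP
  set R := ∑ r, ∑ s, sgn r * sgn s * A r s * A r s with hR
  have key : ∀ a b, SE2 A a b l m * v a * v b =
      A a l * A b m * v a * v b + A a m * A b l * v a * v b
        + (1 / 2 * eta l m * R - P) * (eta a b * v a * v b)
        - eta l m * ((∑ r, sgn r * A a r * A b r) * v a * v b) := fun a b => by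
    rw [SE2, ← hP, ← hR]
    ring
  simp only [key, Finset.sum_add_distrib, Finset.sum_sub_distrib, ← Finset.mul_sum]
  rw [sum_sum_mul_mul_s16 (fun a => A a l) (fun b => A b m),
    sum_sum_mul_mul_s16 (fun a => A a m) (fun b => A b l), sum_sum_eta_mul, hv, hQ]
  ring

lemma two_mul_sq_add_mSq {n : ℕ} [NeZero n] (B : Fin n → ℝ) :
    2 * B 0 * B 0 + mSq B = ∑ i, B i ^ 2 := by
  have h : ∀ i : Fin n, B i ^ 2 = sgn i * B i * B i + if i = 0 then 2 * B 0 * B 0 else 0 := by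
    intro i
    by_cases hi : i = 0
    · subst hi
      simp [sgn]
      ring
    · have hi' : (i : ℕ) ≠ 0 := fun h => hi (Fin.ext (by simpa using h))
      simp [sgn, hi, hi']
      ring
  simp only [h, Finset.sum_add_distrib, mSq]
  simp [add_comm]

lemma sum_sum_SE2_eq_zero_iff {n : ℕ} [NeZero n] (A : Fin n → Fin n → ℝ) (v : Fin n → ℝ)
    (hv : mSq v = 0) :
    (∀ l m : Fin n, ∑ a, ∑ b, SE2 A a b l m * v a * v b = 0) ↔
      ∀ r : Fin n, ∑ a, v a * A a r = 0 := by
  simp only [sum_sum_SE2_of_null A v hv]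
  constructor
  · intro h r
    have h00 := h 0 0
    have hsum := two_mul_sq_add_mSq (fun r => ∑ a, v a * A a r)
    have heta : eta (0 : Fin n) 0 = -1 := by simp [eta, sgn]
    rw [heta] at h00
    have hzero : ∑ r, (∑ a, v a * A a r) ^ 2 = 0 := by linarith
    rw [Finset.sum_eq_zero_iff_of_nonneg fun _ _ => sq_nonneg _] at hzero
    exact pow_eq_zero_iff two_ne_zero |>.mp (hzero r (Finset.mem_univ r))
  · intro h l m
    simp [h, mSq]

/-- Exchanging the two index pairs of the superenergy tensor amounts to transposing the array. -/
lemma SE2_swap {n : ℕ} (A : Fin n → Fin n → ℝ) (a b l m : Fin n) :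
    SE2 A a b l m = SE2 (fun i j => A j i) l m a b := by
  have h : ∑ r, ∑ s, sgn r * sgn s * A s r * A s r =
      ∑ r, ∑ s, sgn r * sgn s * A r s * A r s := by
    rw [Finset.sum_comm]
    exact Finset.sum_congr rfl fun r _ => Finset.sum_congr rfl fun s _ => by ring
  simp only [SE2, h]
  ring

/-- T_{αβλμ}ℓ^αℓ^β = 0 iff ℓ^μ A_{μν} = 0, and
T_{αβλμ}ℓ^λℓ^μ = 0 iff A_{μν}ℓ^ν = 0, for null ℓ. -/
theorem stmt_16 {n : ℕ} (hn : 2 ≤ n) (A : Fin n → Fin n → ℝ)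
    (ℓ : Fin n → ℝ) (hℓ0 : ℓ ≠ 0) (hnull : mSq ℓ = 0) :
    ((∀ l m : Fin n, ∑ a, ∑ b, SE2 A a b l m * ℓ a * ℓ b = 0) ↔
      (∀ v : Fin n, ∑ m, ℓ m * A m v = 0)) ∧
    ((∀ a b : Fin n, ∑ l, ∑ m, SE2 A a b l m * ℓ l * ℓ m = 0) ↔
      (∀ m : Fin n, ∑ v, A m v * ℓ v = 0)) := by
  have : NeZero n := ⟨by omega⟩
  refine ⟨sum_sum_SE2_eq_zero_iff A ℓ hnull, ?_⟩
  simp only [SE2_swap A, mul_comm (A _ _) (ℓ _)]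
  exact sum_sum_SE2_eq_zero_iff (fun i j => A j i) ℓ hnull
end
end
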